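/- arXiv:0906.4059 — 2 statements merged into one kernel-verified Lean document; each statement's English description precedes it below -/
import Mathlib

section
/- For the random-walk dynamical system, assume (i) Σ_{β∈ℤ^d} |β|^ν p_β<∞ where ν:=max{2,⌊d/2⌋+1}, and (ii) the subgroup of ℤ^d generated by {β^{(j)}−β^{(j')} : j∈Z_N} is all of ℤ^d. Then for every m∈ℕ and every F,G∈𝔊_m such that F is ℤ^d-periodic (F(α,y)=F(0,y) for all α∈ℤ^d, y∈[0,1)²), the average Avg((F∘T^n)G) exists for all n large enough and lim_{n→∞} Avg((F∘T^n)G) = Avg(F)·Avg(G). -/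
noncomputable section

open MeasureTheory Filter Topology

/-- The phase space `X = ℤ^d × [0,1)²` (embedded in `ℤ^d × ℝ²`; the invariant measure
is supported on `ℤ^d × [0,1)²`). -/
abbrev RWSpace (d : ℕ) := (Fin d → ℤ) × ℝ × ℝ

/-- The data of a random walk on `ℤ^d`: a probability distribution `p` on `ℤ^d` together
with an enumeration `e` of `ℤ^d` (whose restriction to the support of `p` enumerates the
set `D` of active directions; indices carrying zero probability contribute empty
rectangles and do not affect the map). -/
structure RW (d : ℕ) where
  p : (Fin d → ℤ) → ℝ
  nonneg : ∀ β, 0 ≤ p β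
  total : HasSum p 1
  e : ℕ ≃ (Fin d → ℤ)

namespace RW

variable {d : ℕ}

/-- The cumulative sums `q_k = Σ_{j<k} p_{β^{(j)}}`. -/
def q (R : RW d) (k : ℕ) : ℝ := ∑ j ∈ Finset.range k, R.p (R.e j)

/-- The index `k` such that `y ∈ [q_k, q_{k+1})` (for `y ∈ [0,1)`). -/
def idx (R : RW d) (y : ℝ) : ℕ := sSup {j | R.q j ≤ y}

/-- The random-walk (coupled bakers') map
`T(α; y₁, y₂) = (α + β^{(k)}; p_{β^{(k)}}⁻¹(y₁ − q_{k-1}), p_{β^{(k)}} y₂ + q_{k-1})`. -/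
def T (R : RW d) : RWSpace d → RWSpace d := fun x =>
  (x.1 + R.e (R.idx x.2.1),
   (x.2.1 - R.q (R.idx x.2.1)) / R.p (R.e (R.idx x.2.1)),
   R.p (R.e (R.idx x.2.1)) * x.2.2 + R.q (R.idx x.2.1))

/-- The inverse of the random-walk map. -/
def Tinv (R : RW d) : RWSpace d → RWSpace d := fun x =>
  (x.1 - R.e (R.idx x.2.2),
   R.p (R.e (R.idx x.2.2)) * x.2.1 + R.q (R.idx x.2.2),
   (x.2.2 - R.q (R.idx x.2.2)) / R.p (R.e (R.idx x.2.2)))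

/-- The iterate `T^t` for `t ∈ ℤ` (using the inverse map for negative times). -/
def iterZ (R : RW d) (t : ℤ) : RWSpace d → RWSpace d :=
  if 0 ≤ t then (R.T)^[t.toNat] else (R.Tinv)^[(-t).toNat]

end RW

/-- The invariant measure `μ`: counting measure on `ℤ^d` times Lebesgue measure on
`[0,1)²`. -/
def rwMeasure (d : ℕ) : Measure (RWSpace d) :=
  (Measure.count : Measure (Fin d → ℤ)).prod
    ((volume.restrict (Set.Ico (0:ℝ) 1)).prod (volume.restrict (Set.Ico (0:ℝ) 1)))

/-- The set `V = B_{γ,r} × [0,1)²`, where `B_{γ,r}` is the square box of center `γ` and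
radius `r` in `ℤ^d`. -/
def rwBox {d : ℕ} (γ : Fin d → ℤ) (r : ℕ) : Set (RWSpace d) :=
  {x | (∀ i, |x.1 i - γ i| ≤ (r : ℤ)) ∧ x.2.1 ∈ Set.Ico (0:ℝ) 1 ∧ x.2.2 ∈ Set.Ico (0:ℝ) 1}

/-- The exhaustive family `𝒱 = {B_{γ,r} × [0,1)² : γ ∈ ℤ^d, r ∈ ℤ⁺}`. -/
def rwFamily (d : ℕ) : Set (Set (RWSpace d)) :=
  {V | ∃ γ : Fin d → ℤ, ∃ r : ℕ, 1 ≤ r ∧ V = rwBox γ r}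

/-- The (μ-uniform) infinite-volume limit of a set function `φ` along the family `𝒱`
equals `L`. -/
def IVLim {Y : Type*} [MeasurableSpace Y] (μ : Measure Y) (𝒱 : Set (Set Y))
    (φ : Set Y → ℝ) (L : ℝ) : Prop :=
  ∀ ε > 0, ∃ M : ℝ, 0 < M ∧ ∀ V ∈ 𝒱, M ≤ (μ V).toReal → |φ V - L| < ε

/-- The normalized average `μ_V(F) = (1/μ(V)) ∫_V F dμ` of `F` over a set `V`. -/
def avgOn {Y : Type*} [MeasurableSpace Y] (μ : Measure Y) (F : Y → ℝ) (V : Set Y) : ℝ :=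
  (∫ x in V, F x ∂μ) / (μ V).toReal

/-- `F` possesses the infinite-volume average `L` along the family `𝒱`. -/
def HasAvg {Y : Type*} [MeasurableSpace Y] (μ : Measure Y) (𝒱 : Set (Set Y))
    (F : Y → ℝ) (L : ℝ) : Prop :=
  IVLim μ 𝒱 (avgOn μ F) L

/-- The σ-algebra `ℬ` generated by the partition `{S_α}` of the phase space into unit
squares `S_α = {α} × [0,1)²`. -/
def rwB0 (d : ℕ) : MeasurableSpace (RWSpace d) :=
  MeasurableSpace.generateFrom
    {S | ∃ α : Fin d → ℤ, S = {α} ×ˢ (Set.Ico (0:ℝ) 1 ×ˢ Set.Ico (0:ℝ) 1)}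

/-- The σ-algebra `T^k ℬ = {T^{-k} A : A ∈ ℬ}` for `k ∈ ℤ`. -/
def rwBk {d : ℕ} (R : RW d) (k : ℤ) : MeasurableSpace (RWSpace d) :=
  MeasurableSpace.comap (RW.iterZ R k) (rwB0 d)

/-- The σ-algebra `ℬ_{ℓ,m} = T^ℓ ℬ ∨ ⋯ ∨ T^m ℬ`. -/
def rwBlm {d : ℕ} (R : RW d) (l m : ℤ) : MeasurableSpace (RWSpace d) :=
  ⨆ k ∈ Finset.Icc l m, rwBk R k

/-- `L^∞(X, ℬ_{−m,m}, μ)`: bounded observables measurable w.r.t. `ℬ_{−m,m}`. -/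
def rwLinftyB {d : ℕ} (R : RW d) (m : ℕ) : Set (RWSpace d → ℝ) :=
  {F | Measurable[rwBlm R (-(m : ℤ)) (m : ℤ)] F ∧ ∃ C, ∀ x, |F x| ≤ C}

/-- The class of global observables `𝔊_m`. -/
def rwG {d : ℕ} (R : RW d) (m : ℕ) : Set (RWSpace d → ℝ) :=
  {F | F ∈ rwLinftyB R m ∧ ∃ A : ℝ, HasAvg (rwMeasure d) (rwFamily d) F A}

/-- The sets that do not separate points related by `r`. -/
@[reducible] def saturatedSpace {X : Type*} (r : X → X → Prop) : MeasurableSpace X where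
  MeasurableSet' A := ∀ x x', r x x' → (x ∈ A ↔ x' ∈ A)
  measurableSet_empty _ _ _ := Iff.rfl
  measurableSet_compl _ hA x x' h := not_congr (hA x x' h)
  measurableSet_iUnion A hA x x' h := by
    simp only [Set.mem_iUnion]
    exact exists_congr fun i => hA i x x' h

theorem eq_of_measurable_saturatedSpace {X : Type*} {r : X → X → Prop} {m : MeasurableSpace X}
    (hm : m ≤ saturatedSpace r) {G : X → ℝ} (hG : Measurable[m] G) {x x' : X} (h : r x x') :
    G x = G x' :=
  ((hm _ (hG (measurableSet_singleton (G x))) x x' h).1 rfl).symm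

/-- Lebesgue measure on `[0,1)`. -/
abbrev unitVol : Measure ℝ := volume.restrict (Set.Ico (0:ℝ) 1)

instance : IsProbabilityMeasure unitVol := ⟨by simp [unitVol]⟩

/-- The half-open unit square. -/
abbrev unitSquare : Set (ℝ × ℝ) := Set.Ico (0:ℝ) 1 ×ˢ Set.Ico (0:ℝ) 1

theorem ae_mem_unitSquare : ∀ᵐ y ∂(unitVol.prod unitVol), y ∈ unitSquare := by
  rw [Measure.prod_restrict]
  exact ae_restrict_mem (measurableSet_Ico.prod measurableSet_Ico)

namespace RW

variable {d : ℕ}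

theorem q_succ (R : RW d) (k : ℕ) : R.q (k + 1) = R.q k + R.p (R.e k) :=
  Finset.sum_range_succ _ _

theorem q_mono (R : RW d) : Monotone R.q :=
  monotone_nat_of_le_succ fun k => by rw [q_succ]; linarith [R.nonneg (R.e k)]

theorem q_nonneg (R : RW d) (k : ℕ) : 0 ≤ R.q k := Finset.sum_nonneg fun _ _ => R.nonneg _

theorem tendsto_q (R : RW d) : Tendsto R.q atTop (𝓝 1) :=
  (R.e.hasSum_iff.2 R.total).tendsto_sum_nat

theorem q_le_one (R : RW d) (k : ℕ) : R.q k ≤ 1 := R.q_mono.ge_of_tendsto R.tendsto_q k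

theorem idx_eq_of_mem (R : RW d) {y : ℝ} {k : ℕ} (hy : y ∈ Set.Ico (R.q k) (R.q (k + 1))) :
    R.idx y = k := by
  have h : {j | R.q j ≤ y} = Set.Iic k := by
    ext j
    simp only [Set.mem_ofPred_eq, Set.mem_Iic]
    refine ⟨fun h => ?_, fun h => (R.q_mono h).trans hy.1⟩
    by_contra! hk
    exact absurd (R.q_mono hk) (not_le.2 (h.trans_lt hy.2))
  rw [idx, h, csSup_Iic]

theorem mem_Ico_idx (R : RW d) {y : ℝ} (hy : y ∈ Set.Ico (0:ℝ) 1) :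
    y ∈ Set.Ico (R.q (R.idx y)) (R.q (R.idx y + 1)) := by
  classical
  have hex : ∃ n, y < R.q n := (R.tendsto_q.eventually_const_lt hy.2).exists
  have hpos : Nat.find hex ≠ 0 := fun h => by
    have := Nat.find_spec hex
    rw [h] at this
    simp only [q, Finset.range_zero, Finset.sum_empty] at this
    exact absurd hy.1 (not_le.2 this)
  obtain ⟨k, hk⟩ := Nat.exists_eq_succ_of_ne_zero hpos
  have hmem : y ∈ Set.Ico (R.q k) (R.q (k + 1)) :=
    ⟨not_lt.1 (Nat.find_min hex (by omega)), by simpa [hk] using Nat.find_spec hex⟩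
  rwa [R.idx_eq_of_mem hmem]

theorem Ico_inter_idx_preimage (R : RW d) (k : ℕ) :
    Set.Ico (0:ℝ) 1 ∩ R.idx ⁻¹' {k} = Set.Ico (R.q k) (R.q (k + 1)) := by
  ext y
  refine ⟨fun ⟨hy, hk⟩ => ?_, fun hy => ⟨⟨(R.q_nonneg k).trans hy.1,
    hy.2.trans_le (R.q_le_one _)⟩, R.idx_eq_of_mem hy⟩⟩
  have := R.mem_Ico_idx hy
  rwa [Set.mem_preimage.1 hk] at this

theorem idx_eq_zero_of_notMem (R : RW d) {y : ℝ} (hy : y ∉ Set.Ico (0:ℝ) 1) : R.idx y = 0 := by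
  rcases lt_or_ge y 0 with h | h
  · have : {j | R.q j ≤ y} = ∅ := by
      ext j
      simpa using h.trans_le (R.q_nonneg j)
    rw [idx, this, csSup_empty, bot_eq_zero]
  · have : {j | R.q j ≤ y} = Set.univ := by
      ext j
      simp only [Set.mem_ofPred_eq, Set.mem_univ, iff_true]
      exact (R.q_le_one j).trans (not_lt.1 fun h' => hy ⟨h, h'⟩)
    rw [idx, this]
    exact Nat.sSup_of_not_bddAbove not_bddAbove_univ

@[fun_prop]
theorem measurable_idx (R : RW d) : Measurable R.idx := by
  refine measurable_to_countable' fun k => ?_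
  rw [← Set.inter_union_compl (R.idx ⁻¹' {k}) (Set.Ico (0:ℝ) 1), Set.inter_comm,
    R.Ico_inter_idx_preimage]
  refine measurableSet_Ico.union ?_
  by_cases hk : k = 0
  · rw [Set.inter_eq_right.2 fun y hy => by simp [R.idx_eq_zero_of_notMem hy, hk]]
    exact measurableSet_Ico.compl
  · convert MeasurableSet.empty
    ext y
    simp only [Set.mem_inter_iff, Set.mem_preimage, Set.mem_singleton_iff, Set.mem_compl_iff,
      Set.mem_empty_iff_false, iff_false, not_and, not_not]
    intro h
    by_contra hy
    exact hk (h.symm.trans (R.idx_eq_zero_of_notMem hy))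

/-- The probability of the direction of index `k`. -/
def weight (R : RW d) (k : ℕ) : ℝ := R.p (R.e k)

/-- The expanding interval map given by the first coordinate of `T`. -/
def shift (R : RW d) (y : ℝ) : ℝ := (y - R.q (R.idx y)) / R.weight (R.idx y)

/-- The inverse branches of `shift`. -/
def branch (R : RW d) (z : ℕ × ℝ) : ℝ := R.weight z.1 * z.2 + R.q z.1

/-- The action of `T` on the unit square. -/
def baker (R : RW d) (y : ℝ × ℝ) : ℝ × ℝ := (R.shift y.1, R.branch (R.idx y.1, y.2))

@[fun_prop]
theorem measurable_shift (R : RW d) : Measurable R.shift := by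
  have h1 : Measurable R.q := measurable_of_countable _
  have h2 : Measurable R.weight := measurable_of_countable _
  unfold shift
  fun_prop

@[fun_prop]
theorem measurable_branch (R : RW d) : Measurable R.branch := by
  have h1 : Measurable R.q := measurable_of_countable _
  have h2 : Measurable R.weight := measurable_of_countable _
  unfold branch
  fun_prop

@[fun_prop]
theorem measurable_baker (R : RW d) : Measurable R.baker := by
  unfold baker
  fun_prop

theorem T_apply (R : RW d) (x : RWSpace d) : R.T x = (x.1 + R.e (R.idx x.2.1), R.baker x.2) := rfl

theorem measurable_T (R : RW d) : Measurable R.T := by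
  have h : Measurable fun k => R.e k := measurable_of_countable _
  change Measurable fun x : RWSpace d => (x.1 + R.e (R.idx x.2.1), R.baker x.2)
  fun_prop

theorem measurable_Tinv (R : RW d) : Measurable R.Tinv := by
  have h : Measurable fun k => R.e k := measurable_of_countable _
  change Measurable fun x : RWSpace d =>
    (x.1 - R.e (R.idx x.2.2), R.branch (R.idx x.2.2, x.2.1), R.shift x.2.2)
  fun_prop

theorem weight_idx_pos (R : RW d) {y : ℝ} (hy : y ∈ Set.Ico (0:ℝ) 1) : 0 < R.weight (R.idx y) := by
  have h := R.mem_Ico_idx hy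
  rw [q_succ] at h
  unfold weight
  linarith [h.1, h.2]

theorem branch_idx_shift (R : RW d) {y : ℝ} (hy : y ∈ Set.Ico (0:ℝ) 1) :
    R.branch (R.idx y, R.shift y) = y := by
  have := R.weight_idx_pos hy
  simp only [branch, shift]
  field_simp
  ring

theorem shift_mem (R : RW d) {y : ℝ} (hy : y ∈ Set.Ico (0:ℝ) 1) :
    R.shift y ∈ Set.Ico (0:ℝ) 1 := by
  have hp := R.weight_idx_pos hy
  have h := R.mem_Ico_idx hy
  rw [q_succ] at h
  refine ⟨div_nonneg (by linarith [h.1]) hp.le, ?_⟩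
  rw [shift, div_lt_one hp, weight]
  linarith [h.2]

theorem branch_mem_Ico (R : RW d) {k : ℕ} (hk : 0 < R.weight k) {y : ℝ}
    (hy : y ∈ Set.Ico (0:ℝ) 1) : R.branch (k, y) ∈ Set.Ico (R.q k) (R.q (k + 1)) := by
  rw [q_succ]
  change R.weight k * y + R.q k ∈ Set.Ico (R.q k) (R.q k + R.weight k)
  exact ⟨by nlinarith [hy.1], by nlinarith [hy.2]⟩

theorem baker_mem (R : RW d) {y : ℝ × ℝ} (hy : y ∈ unitSquare) : R.baker y ∈ unitSquare := by
  have h := R.branch_mem_Ico (R.weight_idx_pos hy.1) hy.2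
  exact ⟨R.shift_mem hy.1, (R.q_nonneg _).trans h.1, h.2.trans_le (R.q_le_one _)⟩

theorem iterate_baker_mem (R : RW d) (n : ℕ) {y : ℝ × ℝ} (hy : y ∈ unitSquare) :
    R.baker^[n] y ∈ unitSquare := by
  induction n with
  | zero => exact hy
  | succ n ih => rw [Function.iterate_succ_apply']; exact R.baker_mem ih

theorem Tinv_T (R : RW d) {x : RWSpace d} (hx : x.2 ∈ unitSquare) : R.Tinv (R.T x) = x := by
  have hp := R.weight_idx_pos hx.1
  have hidx : R.idx (R.branch (R.idx x.2.1, x.2.2)) = R.idx x.2.1 :=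
    R.idx_eq_of_mem (R.branch_mem_Ico hp hx.2)
  change (x.1 + R.e (R.idx x.2.1) - R.e (R.idx (R.branch (R.idx x.2.1, x.2.2))),
    R.branch (R.idx (R.branch (R.idx x.2.1, x.2.2)), R.shift x.2.1),
    R.shift (R.branch (R.idx x.2.1, x.2.2))) = x
  have hshift : R.shift (R.branch (R.idx x.2.1, x.2.2)) = x.2.2 := by
    rw [shift, hidx, branch]
    field_simp
    ring
  rw [hshift, hidx, R.branch_idx_shift hx.1, add_sub_cancel_right]

theorem iterate_T_snd (R : RW d) (n : ℕ) (x : RWSpace d) : (R.T^[n] x).2 = R.baker^[n] x.2 := by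
  induction n generalizing x with
  | zero => rfl
  | succ n ih => rw [Function.iterate_succ_apply, ih, Function.iterate_succ_apply, T_apply]

theorem iterate_baker_fst (R : RW d) (n : ℕ) (y : ℝ × ℝ) : (R.baker^[n] y).1 = R.shift^[n] y.1 := by
  induction n generalizing y with
  | zero => rfl
  | succ n ih => rw [Function.iterate_succ_apply, ih, Function.iterate_succ_apply, baker]

theorem iterate_T_fst (R : RW d) (n : ℕ) (x : RWSpace d) :
    (R.T^[n] x).1 = x.1 + ∑ i ∈ Finset.range n, R.e (R.idx (R.shift^[i] x.2.1)) := by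
  induction n with
  | zero => simp
  | succ n ih =>
    rw [Function.iterate_succ_apply', T_apply, ih, iterate_T_snd, iterate_baker_fst,
      Finset.sum_range_succ, add_assoc]

theorem iterate_Tinv_iterate_T (R : RW d) (i j : ℕ) {x : RWSpace d} (hx : x.2 ∈ unitSquare) :
    R.Tinv^[i] (R.T^[i + j] x) = R.T^[j] x := by
  induction i with
  | zero => simp
  | succ i ih =>
    rw [Function.iterate_succ_apply, show i + 1 + j = (i + j) + 1 by ring,
      Function.iterate_succ_apply', Tinv_T, ih]
    rw [iterate_T_snd]
    exact R.iterate_baker_mem _ hx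

theorem iterZ_iterate_T (R : RW d) {m : ℕ} {k : ℤ} (hk : k ∈ Finset.Icc (-(m : ℤ)) m)
    {x : RWSpace d} (hx : x.2 ∈ unitSquare) :
    R.iterZ k (R.T^[m] x) = R.T^[(k + m).toNat] x := by
  rw [Finset.mem_Icc] at hk
  unfold iterZ
  split_ifs with h
  · rw [← Function.iterate_add_apply]
    congr 2
    omega
  · rw [← R.iterate_Tinv_iterate_T (-k).toNat (k + m).toNat hx]
    congr 3
    omega

theorem measurable_iterZ (R : RW d) (k : ℤ) : Measurable (R.iterZ k) := by
  unfold iterZ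
  split_ifs
  · exact R.measurable_T.iterate _
  · exact R.measurable_Tinv.iterate _

/-- An encoding of the first `N` symbols of the itinerary of `y` under `shift`. -/
def word (R : RW d) : ℕ → ℝ → ℕ
  | 0, _ => 0
  | N + 1, y => Nat.pair (R.idx y) (word R N (R.shift y))

@[fun_prop]
theorem measurable_word (R : RW d) (N : ℕ) : Measurable (R.word N) := by
  induction N with
  | zero => exact measurable_const
  | succ N ih =>
    have h : Measurable fun k : ℕ × ℕ => Nat.pair k.1 k.2 := measurable_of_countable _
    exact h.comp (R.measurable_idx.prodMk (ih.comp R.measurable_shift))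

theorem idx_iterate_shift_eq_of_word_eq (R : RW d) {N : ℕ} {y y' : ℝ}
    (h : R.word N y = R.word N y') {i : ℕ} (hi : i < N) :
    R.idx (R.shift^[i] y) = R.idx (R.shift^[i] y') := by
  induction N generalizing y y' i with
  | zero => omega
  | succ N ih =>
    obtain ⟨h0, h1⟩ := Nat.pair_eq_pair.1 h
    cases i with
    | zero => exact h0
    | succ i => exact ih h1 (by omega)

theorem unitVol_idx_shift (R : RW d) (k : ℕ) (B : Set ℝ) :
    unitVol (R.idx ⁻¹' {k} ∩ R.shift ⁻¹' B) = ENNReal.ofReal (R.weight k) * unitVol B := by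
  have hinter : Set.Ico (0:ℝ) 1 ∩ (R.idx ⁻¹' {k} ∩ R.shift ⁻¹' B) =
      Set.Ico (R.q k) (R.q (k + 1)) ∩ R.shift ⁻¹' B := by
    rw [← Set.inter_assoc, R.Ico_inter_idx_preimage]
  rw [Measure.restrict_apply' measurableSet_Ico, Set.inter_comm, hinter,
    Measure.restrict_apply' measurableSet_Ico]
  rcases (R.nonneg (R.e k)).eq_or_lt with hp | hp
  · simp [weight, q_succ, ← hp]
  · change 0 < R.weight k at hp
    have h : Set.Ico (R.q k) (R.q (k + 1)) ∩ R.shift ⁻¹' B =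
        (fun y => y + -R.q k) ⁻¹' ((fun y => y * (R.weight k)⁻¹) ⁻¹' (B ∩ Set.Ico 0 1)) := by
      ext y
      have hiff : (y - R.q k) * (R.weight k)⁻¹ ∈ Set.Ico (0:ℝ) 1 ↔
          y ∈ Set.Ico (R.q k) (R.q (k + 1)) := by
        rw [q_succ, ← div_eq_mul_inv, Set.mem_Ico, Set.mem_Ico, div_lt_one hp,
          le_div_iff₀ hp, zero_mul, sub_nonneg, sub_lt_iff_lt_add', weight]
      simp only [Set.mem_inter_iff, Set.mem_preimage, ← sub_eq_add_neg, hiff]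
      refine ⟨fun ⟨h1, h2⟩ => ⟨?_, h1⟩, fun ⟨h1, h2⟩ => ⟨h2, ?_⟩⟩
      · rwa [shift, R.idx_eq_of_mem h1, div_eq_mul_inv] at h2
      · rwa [shift, R.idx_eq_of_mem h2, div_eq_mul_inv]
    rw [h, measure_preimage_add_right, Real.volume_preimage_mul_right (inv_ne_zero hp.ne'),
      inv_inv, abs_of_pos hp]

theorem measurePreserving_idx_shift (R : RW d) :
    MeasurePreserving (fun y => (R.idx y, R.shift y)) unitVol
      ((unitVol.map R.idx).prod unitVol) := by
  have := Measure.isProbabilityMeasure_map (μ := unitVol) R.measurable_idx.aemeasurable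
  refine ⟨by fun_prop, (Measure.prod_eq fun A B hA hB => ?_).symm⟩
  rw [Measure.map_apply (by fun_prop) (hA.prod hB)]
  have key : (unitVol.restrict (R.shift ⁻¹' B)).map R.idx = unitVol B • unitVol.map R.idx := by
    refine Measure.ext_of_singleton fun k => ?_
    rw [Measure.map_apply R.measurable_idx (measurableSet_singleton k),
      Measure.restrict_apply (R.measurable_idx (measurableSet_singleton k)),
      R.unitVol_idx_shift k B, Measure.smul_apply,
      Measure.map_apply R.measurable_idx (measurableSet_singleton k), smul_eq_mul]
    have h := R.unitVol_idx_shift k Set.univ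
    rw [Set.preimage_univ, Set.inter_univ, measure_univ, mul_one] at h
    rw [h, mul_comm]
  have h := congrArg (fun ν => ν A) key
  simp only [Measure.smul_apply, smul_eq_mul] at h
  rw [Measure.map_apply R.measurable_idx hA,
    Measure.restrict_apply (R.measurable_idx hA)] at h
  rw [mul_comm, ← h]
  rfl

theorem measurePreserving_branch (R : RW d) :
    MeasurePreserving R.branch ((unitVol.map R.idx).prod unitVol) unitVol := by
  refine ⟨R.measurable_branch, ?_⟩
  rw [← R.measurePreserving_idx_shift.map_eq, Measure.map_map (by fun_prop) (by fun_prop)]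
  refine (Measure.map_congr ?_).trans Measure.map_id
  filter_upwards [ae_restrict_mem measurableSet_Ico] with y hy
  exact R.branch_idx_shift hy

theorem measurePreserving_baker (R : RW d) :
    MeasurePreserving R.baker (unitVol.prod unitVol) (unitVol.prod unitVol) := by
  have := Measure.isProbabilityMeasure_map (μ := unitVol) R.measurable_idx.aemeasurable
  have h1 := R.measurePreserving_idx_shift.prod (MeasurePreserving.id unitVol)
  have h2 := (Measure.measurePreserving_swap (μ := unitVol.map R.idx) (ν := unitVol)).prod
    (MeasurePreserving.id unitVol)
  have h3 := measurePreserving_prodAssoc unitVol (unitVol.map R.idx) unitVol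
  have h4 := (MeasurePreserving.id unitVol).prod R.measurePreserving_branch
  exact h4.comp (h3.comp (h2.comp h1))

theorem exists_measurePreserving_word_iterate_shift (R : RW d) (N : ℕ) :
    ∃ ν : Measure ℕ, IsProbabilityMeasure ν ∧
      MeasurePreserving (fun y => (R.word N y, R.shift^[N] y)) unitVol (ν.prod unitVol) := by
  have := Measure.isProbabilityMeasure_map (μ := unitVol) R.measurable_idx.aemeasurable
  induction N with
  | zero =>
    refine ⟨Measure.dirac 0, inferInstance, by fun_prop, ?_⟩
    rw [Measure.dirac_prod]
    rfl
  | succ N ih =>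
    obtain ⟨ν, hν, h⟩ := ih
    have hpair : Measurable fun k : ℕ × ℕ => Nat.pair k.1 k.2 := measurable_of_countable _
    have h1 := (MeasurePreserving.id (unitVol.map R.idx)).prod h
    have h2 := (measurePreserving_prodAssoc (unitVol.map R.idx) ν unitVol).symm
    have h3 := (hpair.measurePreserving ((unitVol.map R.idx).prod ν)).prod
      (MeasurePreserving.id unitVol)
    have := Measure.isProbabilityMeasure_map (μ := (unitVol.map R.idx).prod ν)
      hpair.aemeasurable
    exact ⟨_, this, h3.comp (h2.comp (h1.comp R.measurePreserving_idx_shift))⟩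

theorem integral_word_mul_iterate_shift (R : RW d) (N : ℕ) (γ : ℕ → ℝ) {h : ℝ → ℝ}
    (hh : Measurable h) :
    ∫ y, h (R.shift^[N] y) * γ (R.word N y) ∂unitVol =
      (∫ y, h y ∂unitVol) * ∫ y, γ (R.word N y) ∂unitVol := by
  obtain ⟨ν, hν, hmp⟩ := R.exists_measurePreserving_word_iterate_shift N
  have hγ : Measurable γ := measurable_of_countable _
  have key (h : ℝ → ℝ) (hh : Measurable h) :
      ∫ y, h (R.shift^[N] y) * γ (R.word N y) ∂unitVol =
        (∫ y, h y ∂unitVol) * ∫ k, γ k ∂ν := by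
    have hm : Measurable fun z : ℕ × ℝ => γ z.1 * h z.2 := by fun_prop
    have h1 := integral_map (μ := unitVol) hmp.aemeasurable hm.aestronglyMeasurable
    rw [hmp.map_eq, integral_prod_mul] at h1
    rw [mul_comm, h1]
    simp only [mul_comm]
  have h1 := key (fun _ => 1) measurable_const
  simp only [one_mul, integral_const, probReal_univ, smul_eq_mul] at h1
  rw [key h hh, h1]

theorem integral_word_mul_word (R : RW d) {N n : ℕ} (hn : N ≤ n) (φ γ : ℕ → ℝ) :
    ∫ y, φ (R.word N (R.shift^[n] y)) * γ (R.word N y) ∂unitVol =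
      (∫ y, φ (R.word N y) ∂unitVol) * ∫ y, γ (R.word N y) ∂unitVol := by
  have hφ : Measurable φ := measurable_of_countable _
  have hm : Measurable fun y => φ (R.word N y) := by fun_prop
  obtain ⟨k, rfl⟩ := Nat.exists_eq_add_of_le' hn
  have hk : MeasurePreserving R.shift^[k] unitVol unitVol := by
    have hs : MeasurePreserving R.shift unitVol unitVol := by
      have := Measure.isProbabilityMeasure_map (μ := unitVol) R.measurable_idx.aemeasurable
      exact measurePreserving_snd.comp R.measurePreserving_idx_shift
    exact hs.iterate k
  have h1 := integral_map (μ := unitVol) hk.aemeasurable hm.aestronglyMeasurable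
  rw [hk.map_eq] at h1
  simp only [Function.iterate_add_apply]
  exact (R.integral_word_mul_iterate_shift N γ (hm.comp hk.measurable)).trans (by rw [h1]; rfl)

end RW

theorem rwB0_le (d : ℕ) : rwB0 d ≤ (inferInstance : MeasurableSpace (RWSpace d)) := by
  refine MeasurableSpace.generateFrom_le ?_
  rintro _ ⟨α, rfl⟩
  exact (measurableSet_singleton α).prod (measurableSet_Ico.prod measurableSet_Ico)

theorem rwBlm_le {d : ℕ} (R : RW d) (l m : ℤ) :
    rwBlm R l m ≤ (inferInstance : MeasurableSpace (RWSpace d)) :=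
  iSup₂_le fun k _ =>
    (MeasurableSpace.comap_mono (rwB0_le d)).trans (R.measurable_iterZ k).comap_le

theorem rwB0_le_saturatedSpace (d : ℕ) :
    rwB0 d ≤ saturatedSpace fun x x' => x.1 = x'.1 ∧ x.2 ∈ unitSquare ∧ x'.2 ∈ unitSquare := by
  refine MeasurableSpace.generateFrom_le ?_
  rintro _ ⟨α, rfl⟩ x x' ⟨h, hx, hx'⟩
  simp [h, hx, hx']

theorem rwBlm_le_saturatedSpace {d : ℕ} (R : RW d) (l m : ℤ) :
    rwBlm R l m ≤ saturatedSpace fun x x' => ∀ k ∈ Finset.Icc l m,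
      (R.iterZ k x).1 = (R.iterZ k x').1 ∧
        (R.iterZ k x).2 ∈ unitSquare ∧ (R.iterZ k x').2 ∈ unitSquare := by
  refine iSup₂_le fun k hk => ?_
  rintro _ ⟨A, hA, rfl⟩ x x' h
  exact rwB0_le_saturatedSpace d A hA _ _ (h k hk)

theorem exists_eq_word_of_measurable_rwBlm {d : ℕ} (R : RW d) {m : ℕ} {G : RWSpace d → ℝ}
    (hG : Measurable[rwBlm R (-(m : ℤ)) (m : ℤ)] G) (α : Fin d → ℤ) :
    ∃ γ : ℕ → ℝ, ∀ y ∈ unitSquare, G (α, R.baker^[m] y) = γ (R.word (2 * m) y.1) := by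
  have hT (y : ℝ × ℝ) : (α, R.baker^[m] y) =
      R.T^[m] (α - ∑ i ∈ Finset.range m, R.e (R.idx (R.shift^[i] y.1)), y) :=
    Prod.ext (by simp [R.iterate_T_fst]) (by rw [R.iterate_T_snd])
  have key : ∀ y ∈ unitSquare, ∀ y' ∈ unitSquare, R.word (2 * m) y.1 = R.word (2 * m) y'.1 →
      G (α, R.baker^[m] y) = G (α, R.baker^[m] y') := by
    intro y hy y' hy' h
    have hsum (j : ℕ) (hj : j ≤ 2 * m) :
        ∑ i ∈ Finset.range j, R.e (R.idx (R.shift^[i] y.1)) =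
          ∑ i ∈ Finset.range j, R.e (R.idx (R.shift^[i] y'.1)) :=
      Finset.sum_congr rfl fun i hi => by
        rw [R.idx_iterate_shift_eq_of_word_eq h ((Finset.mem_range.1 hi).trans_le hj)]
    refine eq_of_measurable_saturatedSpace (rwBlm_le_saturatedSpace R _ _) hG fun k hk => ?_
    rw [hT, hT, R.iterZ_iterate_T hk hy, R.iterZ_iterate_T hk hy', R.iterate_T_snd,
      R.iterate_T_snd, R.iterate_T_fst, R.iterate_T_fst]
    rw [Finset.mem_Icc] at hk
    refine ⟨?_, R.iterate_baker_mem _ hy, R.iterate_baker_mem _ hy'⟩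
    rw [hsum m (by omega), hsum _ (by omega)]
  classical
  refine ⟨fun w => if h : ∃ y ∈ unitSquare, R.word (2 * m) y.1 = w
    then G (α, R.baker^[m] h.choose) else 0, fun y hy => ?_⟩
  have h : ∃ y' ∈ unitSquare, R.word (2 * m) y'.1 = R.word (2 * m) y.1 := ⟨y, hy, rfl⟩
  simp only [dif_pos h]
  exact key y hy _ h.choose_spec.1 h.choose_spec.2.symm

theorem integral_eq_of_iterate_baker {d : ℕ} (R : RW d) (m : ℕ) {h : ℝ × ℝ → ℝ}
    (hh : Measurable h) {ψ : ℝ → ℝ} (hψ : ∀ y ∈ unitSquare, h (R.baker^[m] y) = ψ y.1) :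
    ∫ y, h y ∂(unitVol.prod unitVol) = ∫ y, ψ y ∂unitVol := by
  have hmp := R.measurePreserving_baker.iterate m
  have h1 := integral_map hmp.aemeasurable hh.aestronglyMeasurable (f := h)
  rw [hmp.map_eq] at h1
  rw [h1, integral_congr_ae (g := fun y => ψ y.1)
    (ae_mem_unitSquare.mono fun y hy => hψ y hy), integral_fun_fst]
  simp

theorem integral_comp_iterate_T_mul {d : ℕ} (R : RW d) {m n : ℕ} (hn : 2 * m ≤ n)
    {F G : RWSpace d → ℝ} (hF : Measurable[rwBlm R (-(m : ℤ)) (m : ℤ)] F)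
    (hG : Measurable[rwBlm R (-(m : ℤ)) (m : ℤ)] G)
    (hper : ∀ (α : Fin d → ℤ) (y₁ y₂ : ℝ), F (α, y₁, y₂) = F (0, y₁, y₂)) (α : Fin d → ℤ) :
    ∫ y, F (R.T^[n] (α, y)) * G (α, y) ∂(unitVol.prod unitVol) =
      (∫ y, F (0, y) ∂(unitVol.prod unitVol)) * ∫ y, G (α, y) ∂(unitVol.prod unitVol) := by
  have hFm : Measurable F := hF.mono (rwBlm_le R _ _) le_rfl
  have hGm : Measurable G := hG.mono (rwBlm_le R _ _) le_rfl
  have hTm := R.measurable_T.iterate n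
  have hFα (x : RWSpace d) : F x = F (0, x.2) := hper x.1 x.2.1 x.2.2
  obtain ⟨φ, hφ⟩ := exists_eq_word_of_measurable_rwBlm R hF 0
  obtain ⟨γ, hγ⟩ := exists_eq_word_of_measurable_rwBlm R hG α
  rw [integral_eq_of_iterate_baker R m (h := fun y => F (0, y))
      (ψ := fun y => φ (R.word (2 * m) y)) (by fun_prop) hφ,
    integral_eq_of_iterate_baker R m (h := fun y => G (α, y))
      (ψ := fun y => γ (R.word (2 * m) y)) (by fun_prop) hγ,
    ← R.integral_word_mul_word hn φ γ]
  refine integral_eq_of_iterate_baker R m (by fun_prop) fun y hy => ?_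
  rw [hγ y hy, hFα, R.iterate_T_snd, ← Function.iterate_add_apply, add_comm,
    Function.iterate_add_apply, hφ _ (R.iterate_baker_mem n hy), R.iterate_baker_fst]

theorem rwBox_eq_prod {d : ℕ} (γ : Fin d → ℤ) (r : ℕ) :
    rwBox γ r = Set.Icc (fun i => γ i - r) (fun i => γ i + r) ×ˢ unitSquare := by
  ext x
  simp only [rwBox, unitSquare, Set.mem_ofPred_eq, Set.mem_prod, Set.mem_Icc, Pi.le_def, abs_le,
    ← forall_and]
  refine and_congr_left fun _ => forall_congr' fun i => ?_
  constructor <;> rintro ⟨h1, h2⟩ <;> constructor <;> linarith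

theorem rwMeasure_restrict_rwBox {d : ℕ} (γ : Fin d → ℤ) (r : ℕ) :
    (rwMeasure d).restrict (rwBox γ r) =
      ((Measure.count : Measure (Fin d → ℤ)).restrict
        (Set.Icc (fun i => γ i - r) (fun i => γ i + r))).prod (unitVol.prod unitVol) := by
  rw [rwMeasure, rwBox_eq_prod, ← Measure.prod_restrict, ← Measure.prod_restrict,
    Measure.restrict_restrict measurableSet_Ico, Set.inter_self]

instance isFiniteMeasure_count_restrict_Icc {d : ℕ} (a b : Fin d → ℤ) :
    IsFiniteMeasure ((Measure.count : Measure (Fin d → ℤ)).restrict (Set.Icc a b)) :=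
  ⟨by simp [Measure.count_apply_lt_top.2 (Set.finite_Icc a b)]⟩

theorem setIntegral_rwBox {d : ℕ} (γ : Fin d → ℤ) (r : ℕ) {H : RWSpace d → ℝ}
    (hH : Measurable H) {C : ℝ} (hC : ∀ x, |H x| ≤ C) :
    ∫ x in rwBox γ r, H x ∂(rwMeasure d) =
      ∫ α in Set.Icc (fun i => γ i - r) (fun i => γ i + r),
        ∫ y, H (α, y) ∂(unitVol.prod unitVol) ∂Measure.count := by
  rw [rwMeasure_restrict_rwBox]
  exact integral_prod _ (.of_bound hH.aestronglyMeasurable C (ae_of_all _ hC))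

theorem toReal_rwMeasure_rwBox {d : ℕ} (γ : Fin d → ℤ) (r : ℕ) :
    (rwMeasure d (rwBox γ r)).toReal = (2 * r + 1) ^ d := by
  rw [← Measure.restrict_apply_univ, rwMeasure_restrict_rwBox, ← Set.univ_prod_univ,
    Measure.prod_prod, measure_univ (μ := unitVol.prod unitVol), mul_one,
    Measure.restrict_apply_univ, ← Finset.coe_Icc,
    Measure.count_apply_finset, Pi.card_Icc, ENNReal.toReal_natCast]
  have h (i : Fin d) : (Finset.Icc (γ i - r) (γ i + r)).card = 2 * r + 1 := by
    rw [Int.card_Icc]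
    omega
  simp [h]

theorem IVLim.unique {d : ℕ} (hd : 1 ≤ d) {φ : Set (RWSpace d) → ℝ} {L L' : ℝ}
    (h : IVLim (rwMeasure d) (rwFamily d) φ L) (h' : IVLim (rwMeasure d) (rwFamily d) φ L') :
    L = L' := by
  refine eq_of_forall_dist_le fun ε hε => ?_
  obtain ⟨M, -, hM⟩ := h (ε / 2) (half_pos hε)
  obtain ⟨M', -, hM'⟩ := h' (ε / 2) (half_pos hε)
  obtain ⟨r, hr⟩ := exists_nat_ge (max M M')
  have hV : (r : ℝ) ≤ (rwMeasure d (rwBox 0 (r + 1))).toReal := by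
    rw [toReal_rwMeasure_rwBox]
    push_cast
    refine le_trans ?_ (le_self_pow₀ (by linarith [r.cast_nonneg (α := ℝ)]) (by omega))
    linarith [r.cast_nonneg (α := ℝ)]
  have hmem : rwBox 0 (r + 1) ∈ rwFamily d := ⟨0, r + 1, by omega, rfl⟩
  have h1 := hM _ hmem (((le_max_left _ _).trans hr).trans hV)
  have h2 := hM' _ hmem (((le_max_right _ _).trans hr).trans hV)
  rw [Real.dist_eq]
  rw [abs_lt] at h1 h2
  rw [abs_le]
  constructor <;> linarith [h1.1, h1.2, h2.1, h2.2]

theorem IVLim.congr {Y : Type*} [MeasurableSpace Y] {μ : Measure Y} {𝒱 : Set (Set Y)}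
    {φ ψ : Set Y → ℝ} {L : ℝ} (h : IVLim μ 𝒱 φ L) (hφψ : ∀ V ∈ 𝒱, φ V = ψ V) :
    IVLim μ 𝒱 ψ L := fun ε hε => by
  obtain ⟨M, hM0, hM⟩ := h ε hε
  exact ⟨M, hM0, fun V hV hMV => hφψ V hV ▸ hM V hV hMV⟩

theorem IVLim.const_mul {Y : Type*} [MeasurableSpace Y] {μ : Measure Y} {𝒱 : Set (Set Y)}
    {φ : Set Y → ℝ} {L : ℝ} (h : IVLim μ 𝒱 φ L) (c : ℝ) :
    IVLim μ 𝒱 (fun V => c * φ V) (c * L) := fun ε hε => by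
  have hc : 0 < |c| + 1 := by positivity
  obtain ⟨M, hM0, hM⟩ := h (ε / (|c| + 1)) (by positivity)
  refine ⟨M, hM0, fun V hV hMV => ?_⟩
  have h1 := hM V hV hMV
  rw [lt_div_iff₀ hc] at h1
  rw [← mul_sub, abs_mul]
  nlinarith [abs_nonneg (φ V - L)]

theorem avgOn_eq_of_periodic {d : ℕ} {F : RWSpace d → ℝ} (hF : Measurable F)
    (hbdd : ∃ C, ∀ x, |F x| ≤ C)
    (hper : ∀ (α : Fin d → ℤ) (y₁ y₂ : ℝ), F (α, y₁, y₂) = F (0, y₁, y₂))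
    {V : Set (RWSpace d)} (hV : V ∈ rwFamily d) :
    avgOn (rwMeasure d) F V = ∫ y, F (0, y) ∂(unitVol.prod unitVol) := by
  obtain ⟨γ, r, -, rfl⟩ := hV
  obtain ⟨C, hC⟩ := hbdd
  have hFα (α : Fin d → ℤ) (y : ℝ × ℝ) : F (α, y) = F (0, y) := hper α y.1 y.2
  have hpos : (rwMeasure d (rwBox γ r)).toReal ≠ 0 := by
    rw [toReal_rwMeasure_rwBox]
    positivity
  have hμ : (rwMeasure d (rwBox γ r)).toReal = (Measure.count : Measure (Fin d → ℤ)).real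
      (Set.Icc (fun i => γ i - r) (fun i => γ i + r)) := by
    rw [← Measure.restrict_apply_univ, rwMeasure_restrict_rwBox, ← Set.univ_prod_univ,
      Measure.prod_prod, measure_univ (μ := unitVol.prod unitVol), mul_one,
    Measure.restrict_apply_univ, measureReal_def]
  rw [avgOn, div_eq_iff hpos, setIntegral_rwBox γ r hF hC]
  simp only [hFα]
  rw [setIntegral_const, hμ, smul_eq_mul, mul_comm]

theorem avgOn_comp_iterate_T_mul {d : ℕ} (R : RW d) {m n : ℕ} (hn : 2 * m ≤ n)
    {F G : RWSpace d → ℝ} (hF : Measurable[rwBlm R (-(m : ℤ)) (m : ℤ)] F)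
    (hFbdd : ∃ C, ∀ x, |F x| ≤ C)
    (hG : Measurable[rwBlm R (-(m : ℤ)) (m : ℤ)] G) (hGbdd : ∃ C, ∀ x, |G x| ≤ C)
    (hper : ∀ (α : Fin d → ℤ) (y₁ y₂ : ℝ), F (α, y₁, y₂) = F (0, y₁, y₂))
    {V : Set (RWSpace d)} (hV : V ∈ rwFamily d) :
    avgOn (rwMeasure d) (fun x => F (R.T^[n] x) * G x) V =
      (∫ y, F (0, y) ∂(unitVol.prod unitVol)) * avgOn (rwMeasure d) G V := by
  obtain ⟨γ, r, -, rfl⟩ := hV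
  obtain ⟨C, hC⟩ := hFbdd
  obtain ⟨C', hC'⟩ := hGbdd
  have hFm : Measurable F := hF.mono (rwBlm_le R _ _) le_rfl
  have hGm : Measurable G := hG.mono (rwBlm_le R _ _) le_rfl
  have hbound (x : RWSpace d) : |F (R.T^[n] x) * G x| ≤ C * C' := by
    rw [abs_mul]
    exact mul_le_mul (hC _) (hC' _) (abs_nonneg _) ((abs_nonneg _).trans (hC x))
  rw [avgOn, avgOn, ← mul_div_assoc, setIntegral_rwBox γ r hGm hC',
    setIntegral_rwBox γ r (H := fun x => F (R.T^[n] x) * G x)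
      ((hFm.comp (R.measurable_T.iterate n)).mul hGm) hbound,
    ← integral_const_mul]
  simp only [integral_comp_iterate_T_mul R hn hF hG hper]

/-- Theorem 4.8(d): under conditions (i) and (ii), for `F, G ∈ 𝔊_m` with `F`
`ℤ^d`-periodic, the average `Avg((F∘T^n)·G)` exists for all large `n` and converges to
`Avg(F)·Avg(G)`. -/
theorem rw_M1_periodic (d : ℕ) (hd : 1 ≤ d) (R : RW d)
    (hcard : ∃ β β' : Fin d → ℤ, 0 < R.p β ∧ 0 < R.p β' ∧ β ≠ β')
    (hmom : Summable fun β : Fin d → ℤ =>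
      Real.sqrt (∑ i, ((β i : ℝ)) ^ 2) ^ (max 2 (d / 2 + 1)) * R.p β)
    (hspan : AddSubgroup.closure
      {γ : Fin d → ℤ | ∃ β β', 0 < R.p β ∧ 0 < R.p β' ∧ γ = β - β'} = ⊤)
    (m : ℕ) (F G : RWSpace d → ℝ)
    (hFmeas : Measurable[rwBlm R (-(m : ℤ)) (m : ℤ)] F)
    (hFbdd : ∃ C, ∀ x, |F x| ≤ C)
    (hGmeas : Measurable[rwBlm R (-(m : ℤ)) (m : ℤ)] G)
    (hGbdd : ∃ C, ∀ x, |G x| ≤ C)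
    (AF AG : ℝ)
    (hAF : HasAvg (rwMeasure d) (rwFamily d) F AF)
    (hAG : HasAvg (rwMeasure d) (rwFamily d) G AG)
    (hper : ∀ (α : Fin d → ℤ) (y₁ y₂ : ℝ), F (α, y₁, y₂) = F (0, y₁, y₂)) :
    ∃ N : ℕ, ∃ a : ℕ → ℝ,
      (∀ n ≥ N, HasAvg (rwMeasure d) (rwFamily d)
        (fun x => F ((R.T)^[n] x) * G x) (a n)) ∧
      Filter.Tendsto a Filter.atTop (𝓝 (AF * AG)) := by
  have hFm : Measurable F := hFmeas.mono (rwBlm_le R _ _) le_rfl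
  have hc : HasAvg (rwMeasure d) (rwFamily d) F (∫ y, F (0, y) ∂(unitVol.prod unitVol)) :=
    fun ε hε => ⟨1, one_pos, fun V hV _ => by
      rwa [avgOn_eq_of_periodic hFm hFbdd hper hV, sub_self, abs_zero]⟩
  have hAFc := IVLim.unique hd hAF hc
  refine ⟨2 * m, fun _ => AF * AG, fun n hn => ?_, tendsto_const_nhds⟩
  refine (IVLim.const_mul hAG AF).congr fun V hV => ?_
  rw [avgOn_comp_iterate_T_mul R hn hFmeas hFbdd hGmeas hGbdd hper hV, hAFc]
end
end

section
/- Let {p_β}_{β∈ℤ^d} be a probability distribution with Σ_β |β|^ν p_β<∞ where ν:=max{2,⌊d/2⌋+1}, and suppose the subgroup of ℤ^d generated by {β−β' : p_β>0, p_{β'}>0} is all of ℤ^d. Let f:ℤ^d→ℝ be bounded and A∈ℝ be such that the box averages (2r+1)^{−d} Σ_{β∈B_{α,r}} f_β converge to A as r→∞, uniformly in α∈ℤ^d. Then lim_{n→∞} Σ_{β∈ℤ^d} p^{(n)}_β f_β = A, where p^{(n)} denotes the n-fold convolution of p with itself. -/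
noncomputable section

open Filter Topology

/-- The Fourier transform `ã(θ) = Σ_{β ∈ ℤ^d} a_β e^{i β·θ}` of a (summable) function
on `ℤ^d`, viewed as a `2π`-periodic function on `ℝ^d`. -/
def ftrans {d : ℕ} (a : (Fin d → ℤ) → ℝ) (θ : Fin d → ℝ) : ℂ :=
  ∑' β : Fin d → ℤ,
    (a β : ℂ) * Complex.exp (Complex.I * ((∑ i, (β i : ℝ) * θ i : ℝ) : ℂ))

/-- The convolution `(a * b)_α = Σ_β a_β b_{α−β}` on `ℤ^d`. -/
def convZ {d : ℕ} (a b : (Fin d → ℤ) → ℝ) : (Fin d → ℤ) → ℝ :=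
  fun α => ∑' β : Fin d → ℤ, a β * b (α - β)

/-- The `n`-fold convolution `p^{(n)} = p * ⋯ * p` (with `p^{(0)} = δ_0`). -/
def convPow {d : ℕ} (p : (Fin d → ℤ) → ℝ) : ℕ → ((Fin d → ℤ) → ℝ)
  | 0 => fun α => if α = 0 then 1 else 0
  | n + 1 => convZ p (convPow p n)

section NormedRing

variable {R : Type*} [NormedRing R]

/-- If `P` and `Q` dominate `s • G` and `t • H`, then `P * Q` dominates `(s * t) • (G * H)`. -/
lemma norm_mul_sub_smul_mul_le [NormedAlgebra ℝ R] {P Q G H : R} {s t : ℝ}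
    (hs : 0 ≤ s) (hs1 : s ≤ 1) (hG : ‖G‖ ≤ 1) (hQ : ‖Q‖ ≤ 1) (hPG : ‖P - s • G‖ ≤ 1 - s)
    (hQH : ‖Q - t • H‖ ≤ 1 - t) :
    ‖P * Q - (s * t) • (G * H)‖ ≤ 1 - s * t := by
  have e : P * Q - (s * t) • (G * H) = (P - s • G) * Q + s • (G * (Q - t • H)) := by
    simp only [sub_mul, mul_sub, smul_sub, smul_mul_assoc, mul_smul_comm, mul_smul]
    abel
  have h1 : ‖(P - s • G) * Q‖ ≤ (1 - s) * 1 :=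
    (norm_mul_le _ _).trans (mul_le_mul hPG hQ (norm_nonneg _) (by linarith))
  have h2 : ‖s • (G * (Q - t • H))‖ ≤ s * (1 * (1 - t)) := by
    rw [norm_smul, Real.norm_of_nonneg hs]
    exact mul_le_mul_of_nonneg_left
      ((norm_mul_le _ _).trans (mul_le_mul hG hQH (norm_nonneg _) zero_le_one)) hs
  rw [e]
  linarith [norm_add_le ((P - s • G) * Q) (s • (G * (Q - t • H)))]

lemma norm_pow_le_one [NormOneClass R] {P : R} (hP : ‖P‖ ≤ 1) (n : ℕ) : ‖P ^ n‖ ≤ 1 :=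
  (norm_pow_le P n).trans (pow_le_one₀ (norm_nonneg _) hP)

variable [NormOneClass R] [NormedAlgebra ℝ R]

lemma norm_pow_sub_smul_pow_le {P x : R} {c : ℝ} (hc : 0 ≤ c) (hc1 : c ≤ 1)
    (hP : ‖P‖ ≤ 1) (hx : ‖x‖ ≤ 1) (h : ‖P - c • x‖ ≤ 1 - c) (n : ℕ) :
    ‖P ^ n - c ^ n • x ^ n‖ ≤ 1 - c ^ n := by
  induction n with
  | zero => simp
  | succ n ih =>
    simp only [pow_succ]
    exact norm_mul_sub_smul_mul_le (pow_nonneg hc n) (pow_le_one₀ hc hc1) (norm_pow_le_one hx n)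
      hP ih h

lemma le_of_tendsto_norm_pow_mul {P G : R} (z : R) {s : ℝ} {k : ℕ} (hs : 0 < s)
    (hP : ‖P‖ ≤ 1) (hcomm : Commute P G) (h : ‖P ^ k - s • G‖ ≤ 1 - s)
    {L : ℝ} (hL : Tendsto (fun n => ‖P ^ n * z‖) atTop (𝓝 L)) : L ≤ ‖G * z‖ := by
  have hstep (n : ℕ) : ‖P ^ (n + k) * z‖ ≤ (1 - s) * ‖P ^ n * z‖ + s * ‖G * z‖ := by
    have e : P ^ (n + k) * z = (P ^ k - s • G) * (P ^ n * z) + s • (P ^ n * (G * z)) := by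
      rw [sub_mul, smul_mul_assoc, ← mul_assoc G, ← (hcomm.pow_left n).eq, mul_assoc (P ^ n) G z,
        sub_add_cancel, add_comm n k, pow_add, mul_assoc]
    have h1 : ‖(P ^ k - s • G) * (P ^ n * z)‖ ≤ (1 - s) * ‖P ^ n * z‖ :=
      (norm_mul_le _ _).trans (mul_le_mul_of_nonneg_right h (norm_nonneg _))
    have h2 : ‖s • (P ^ n * (G * z))‖ ≤ s * ‖G * z‖ := by
      rw [norm_smul, Real.norm_of_nonneg hs.le]
      refine mul_le_mul_of_nonneg_left ((norm_mul_le _ _).trans ?_) hs.le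
      exact mul_le_of_le_one_left (norm_nonneg _) (norm_pow_le_one hP n)
    rw [e]
    exact (norm_add_le _ _).trans (add_le_add h1 h2)
  have := le_of_tendsto_of_tendsto' ((tendsto_add_atTop_iff_nat k).2 hL)
    ((hL.const_mul (1 - s)).add_const (s * ‖G * z‖)) hstep
  nlinarith

/-- A contraction dominating multiples of two commuting contractions `x` and `y` has powers which
asymptotically annihilate `x - y`. -/
lemma tendsto_norm_pow_mul_sub {P x y : R} {c : ℝ} (hc : 0 < c) (hc1 : c ≤ 1)
    (hP : ‖P‖ ≤ 1) (hx : ‖x‖ ≤ 1) (hy : ‖y‖ ≤ 1) (hxy : Commute x y) (hPx : Commute P x)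
    (hPy : Commute P y) (hdx : ‖P - c • x‖ ≤ 1 - c) (hdy : ‖P - c • y‖ ≤ 1 - c) :
    Tendsto (fun n => ‖P ^ n * (x - y)‖) atTop (𝓝 0) := by
  have hanti : Antitone fun n => ‖P ^ n * (x - y)‖ := by
    refine antitone_nat_of_succ_le fun n => ?_
    rw [pow_succ', mul_assoc]
    exact (norm_mul_le _ _).trans (mul_le_of_le_one_left (norm_nonneg _) hP)
  have hL := tendsto_atTop_ciInf hanti ⟨0, by rintro _ ⟨n, rfl⟩; exact norm_nonneg _⟩
  set L := ⨅ n, ‖P ^ n * (x - y)‖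
  have hL0 : 0 ≤ L := ge_of_tendsto' hL fun n => norm_nonneg _
  have hbound (m : ℕ) : L ≤ 2 / ((m : ℝ) + 1) := by
    have hm : (0 : ℝ) < (m : ℝ) + 1 := by positivity
    set S := ∑ i ∈ Finset.range (m + 1), x ^ i * y ^ (m + 1 - 1 - i) with hS
    have hSz : S * (x - y) = x ^ (m + 1) - y ^ (m + 1) := hxy.geom_sum₂_mul (m + 1)
    have hcommS : Commute P S := Commute.sum_right _ _ _ fun i _ =>
      (hPx.pow_right _).mul_right (hPy.pow_right _)
    have hdom : ‖P ^ m - c ^ m • (((m : ℝ) + 1)⁻¹ • S)‖ ≤ 1 - c ^ m := by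
      have e : P ^ m - c ^ m • (((m : ℝ) + 1)⁻¹ • S) = ((m : ℝ) + 1)⁻¹ •
          ∑ i ∈ Finset.range (m + 1), (P ^ m - c ^ m • (x ^ i * y ^ (m + 1 - 1 - i))) := by
        rw [Finset.sum_sub_distrib, ← Finset.smul_sum, ← hS, smul_sub, Finset.sum_const,
          Finset.card_range, ← Nat.cast_smul_eq_nsmul ℝ, smul_comm (c ^ m), Nat.cast_succ,
          inv_smul_smul₀ hm.ne']
      have hi : ∀ i ∈ Finset.range (m + 1),
          ‖P ^ m - c ^ m • (x ^ i * y ^ (m + 1 - 1 - i))‖ ≤ 1 - c ^ m := by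
        intro i hi
        obtain ⟨j, rfl⟩ := Nat.exists_eq_add_of_le (Nat.lt_succ_iff.1 (Finset.mem_range.1 hi))
        have : i + j + 1 - 1 - i = j := by omega
        rw [this, pow_add, pow_add]
        exact norm_mul_sub_smul_mul_le (pow_nonneg hc.le i) (pow_le_one₀ hc.le hc1)
          (norm_pow_le_one hx i) (norm_pow_le_one hP j)
          (norm_pow_sub_smul_pow_le hc.le hc1 hP hx hdx i)
          (norm_pow_sub_smul_pow_le hc.le hc1 hP hy hdy j)
      rw [e, norm_smul, Real.norm_of_nonneg (inv_nonneg.2 hm.le), inv_mul_le_iff₀ hm]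
      refine (norm_sum_le_of_le _ hi).trans (le_of_eq ?_)
      simp [mul_sub, mul_comm]
    have := le_of_tendsto_norm_pow_mul (x - y) (pow_pos hc m) hP
      (hcommS.smul_right _) hdom hL
    refine this.trans ?_
    rw [smul_mul_assoc, hSz, norm_smul, Real.norm_of_nonneg (inv_nonneg.2 hm.le),
      div_eq_inv_mul]
    refine mul_le_mul_of_nonneg_left ((norm_sub_le _ _).trans ?_) (inv_nonneg.2 hm.le)
    linarith [norm_pow_le_one hx (m + 1), norm_pow_le_one hy (m + 1)]
  have hlim : Tendsto (fun m : ℕ => 2 / ((m : ℝ) + 1)) atTop (𝓝 0) :=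
    tendsto_const_nhds.div_atTop (tendsto_natCast_atTop_atTop.atTop_add tendsto_const_nhds)
  have : L = 0 := le_antisymm (ge_of_tendsto' hlim hbound) hL0
  rwa [this] at hL

end NormedRing

section Averaging

open scoped ENNReal

/-- The Banach space of bounded real functions on `ℤ^d`. -/
def BddFun (d : ℕ) : Type := lp (fun _ : Fin d → ℤ => ℝ) ∞

namespace BddFun

variable {d : ℕ}

instance : NormedAddCommGroup (BddFun d) :=
  inferInstanceAs (NormedAddCommGroup (lp (fun _ : Fin d → ℤ => ℝ) ∞))

instance : NormedSpace ℝ (BddFun d) :=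
  inferInstanceAs (NormedSpace ℝ (lp (fun _ : Fin d → ℤ => ℝ) ∞))

instance : CompleteSpace (BddFun d) :=
  inferInstanceAs (CompleteSpace (lp (fun _ : Fin d → ℤ => ℝ) ∞))

instance : FunLike (BddFun d) (Fin d → ℤ) ℝ where
  coe g := g.1
  coe_injective _ _ h := Subtype.ext h

@[ext] lemma ext {g h : BddFun d} (H : ∀ α, g α = h α) : g = h := DFunLike.ext _ _ H

/-- Evaluation at a point of `ℤ^d`, as a continuous linear functional. -/
def evalCLM (α : Fin d → ℤ) : BddFun d →L[ℝ] ℝ :=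
  lp.evalCLM ℝ (fun _ : Fin d → ℤ => ℝ) ∞ α

@[simp] lemma smul_apply (a : ℝ) (g : BddFun d) (α : Fin d → ℤ) : (a • g) α = a * g α := rfl

@[simp] lemma sub_apply (g h : BddFun d) (α : Fin d → ℤ) : (g - h) α = g α - h α := rfl

@[simp] lemma sum_apply {ι : Type*} (s : Finset ι) (g : ι → BddFun d) (α : Fin d → ℤ) :
    (∑ i ∈ s, g i) α = ∑ i ∈ s, g i α :=
  map_sum (evalCLM α) g s

/-- A function on `ℤ^d` bounded by `C`, as an element of `BddFun d`. -/
def mk (f : (Fin d → ℤ) → ℝ) (C : ℝ) (hf : ∀ β, |f β| ≤ C) : BddFun d :=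
  ⟨f, memℓp_infty ⟨C, by rintro _ ⟨β, rfl⟩; exact hf β⟩⟩

@[simp] lemma mk_apply (f : (Fin d → ℤ) → ℝ) (C : ℝ) (hf : ∀ β, |f β| ≤ C)
    (α : Fin d → ℤ) : mk f C hf α = f α := rfl

/-- The constant function with value `a`, as an element of `BddFun d`. -/
def const (d : ℕ) (a : ℝ) : BddFun d := mk (fun _ => a) |a| fun _ => le_rfl

@[simp] lemma const_apply (a : ℝ) (α : Fin d → ℤ) : const d a α = a := rfl

lemma norm_apply_le (g : BddFun d) (α : Fin d → ℤ) : ‖g α‖ ≤ ‖g‖ :=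
  lp.norm_apply_le_norm ENNReal.top_ne_zero g α

lemma norm_le {g : BddFun d} {C : ℝ} (hC : 0 ≤ C) (h : ∀ α, ‖g α‖ ≤ C) : ‖g‖ ≤ C :=
  lp.norm_le_of_forall_le hC h

instance : Nontrivial (BddFun d) :=
  ⟨const d 0, const d 1, fun h => zero_ne_one (DFunLike.congr_fun h 0)⟩

end BddFun

variable {d : ℕ}

/-- The translation operator `(τ_β g)(α) = g(α + β)` on bounded functions on `ℤ^d`. -/
def translation (β : Fin d → ℤ) : BddFun d →L[ℝ] BddFun d :=
  LinearMap.mkContinuous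
    { toFun := fun g => .mk (fun α => g (α + β)) ‖g‖ fun α => g.norm_apply_le _
      map_add' := fun _ _ => rfl
      map_smul' := fun _ _ => rfl } 1 fun g => by
    rw [one_mul]
    exact BddFun.norm_le (norm_nonneg _) fun α => g.norm_apply_le _

@[simp] lemma translation_apply (β : Fin d → ℤ) (g : BddFun d) (α : Fin d → ℤ) :
    translation β g α = g (α + β) := rfl

lemma norm_translation_le (β : Fin d → ℤ) : ‖translation β‖ ≤ 1 :=
  LinearMap.mkContinuous_norm_le _ zero_le_one _

lemma translation_mul (β γ : Fin d → ℤ) :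
    translation β * translation γ = translation (β + γ) := by
  ext g α
  simp [add_assoc]

lemma translation_zero : translation (0 : Fin d → ℤ) = 1 := by
  ext g α
  simp

lemma commute_translation (β γ : Fin d → ℤ) : Commute (translation β) (translation γ) := by
  rw [commute_iff_eq, translation_mul, translation_mul, add_comm]

/-- The averaging operator `(P_q g)(α) = Σ_β q_β g(α + β)` on bounded functions on `ℤ^d`. -/
def averaging (q : (Fin d → ℤ) → ℝ) : BddFun d →L[ℝ] BddFun d :=
  ∑' β, q β • translation β

lemma norm_smul_translation_le (q : (Fin d → ℤ) → ℝ) (β : Fin d → ℤ) :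
    ‖q β • translation β‖ ≤ ‖q β‖ := by
  rw [norm_smul]
  exact mul_le_of_le_one_right (norm_nonneg _) (norm_translation_le β)

lemma summable_smul_translation {q : (Fin d → ℤ) → ℝ} (hq : Summable q) :
    Summable fun β => q β • translation β :=
  Summable.of_norm_bounded hq.norm (norm_smul_translation_le q)

lemma averaging_apply {q : (Fin d → ℤ) → ℝ} (hq : Summable q) (g : BddFun d)
    (α : Fin d → ℤ) : averaging q g α = ∑' β, q β * g (α + β) := by
  have h := (BddFun.evalCLM α).hasSum
    ((ContinuousLinearMap.apply ℝ _ g).hasSum (summable_smul_translation hq).hasSum)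
  exact h.tsum_eq.symm

lemma norm_averaging_le {q : (Fin d → ℤ) → ℝ} {s : ℝ} (hnn : ∀ β, 0 ≤ q β) (hq : HasSum q s) :
    ‖averaging q‖ ≤ s :=
  tsum_of_norm_bounded hq fun β =>
    (norm_smul_translation_le q β).trans (Real.norm_of_nonneg (hnn β)).le

lemma commute_averaging_translation (q : (Fin d → ℤ) → ℝ) (hq : Summable q) (γ : Fin d → ℤ) :
    Commute (averaging q) (translation γ) := by
  rw [commute_iff_eq, averaging, ← (summable_smul_translation hq).tsum_mul_right,
    ← (summable_smul_translation hq).tsum_mul_left]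
  refine tsum_congr fun β => ?_
  rw [smul_mul_assoc, mul_smul_comm, (commute_translation β γ).eq]

lemma norm_averaging_sub_smul_translation_le {p : (Fin d → ℤ) → ℝ} (hnn : ∀ β, 0 ≤ p β)
    (hsum : HasSum p 1) {c : ℝ} {γ : Fin d → ℤ} (hc : c ≤ p γ) :
    ‖averaging p - c • translation γ‖ ≤ 1 - c := by
  have h1 := hsum.sub (hasSum_ite_eq γ c)
  have h2 := (summable_smul_translation hsum.summable).hasSum.sub
    (hasSum_ite_eq γ (c • translation γ))
  rw [averaging, ← h2.tsum_eq]
  refine tsum_of_norm_bounded h1 fun β => ?_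
  by_cases h : β = γ
  · subst h
    simp only [if_true, ← sub_smul]
    rw [norm_smul, Real.norm_of_nonneg (sub_nonneg.2 hc)]
    exact mul_le_of_le_one_right (sub_nonneg.2 hc) (norm_translation_le β)
  · simp only [h, if_false, sub_zero]
    exact (norm_smul_translation_le p β).trans (Real.norm_of_nonneg (hnn β)).le

/-- The powers of the averaging operator are asymptotically translation invariant. -/
lemma tendsto_norm_averaging_pow_mul_translation_sub_one {p : (Fin d → ℤ) → ℝ}
    (hnn : ∀ β, 0 ≤ p β) (hsum : HasSum p 1)
    (hspan : AddSubgroup.closure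
      {γ : Fin d → ℤ | ∃ β β', 0 < p β ∧ 0 < p β' ∧ γ = β - β'} = ⊤) (γ : Fin d → ℤ) :
    Tendsto (fun n => ‖averaging p ^ n * (translation γ - 1)‖) atTop (𝓝 0) := by
  have hP : ‖averaging p‖ ≤ 1 := norm_averaging_le hnn hsum
  have hright {z : BddFun d →L[ℝ] BddFun d} (β : Fin d → ℤ)
      (h : Tendsto (fun n => ‖averaging p ^ n * z‖) atTop (𝓝 0)) :
      Tendsto (fun n => ‖averaging p ^ n * (z * translation β)‖) atTop (𝓝 0) := by
    refine squeeze_zero (fun _ => norm_nonneg _) (fun n => ?_) h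
    rw [← mul_assoc]
    exact (norm_mul_le _ _).trans
      (mul_le_of_le_one_right (norm_nonneg _) (norm_translation_le β))
  have hγ : γ ∈ AddSubgroup.closure
      {γ : Fin d → ℤ | ∃ β β', 0 < p β ∧ 0 < p β' ∧ γ = β - β'} := hspan ▸ AddSubgroup.mem_top γ
  induction hγ using AddSubgroup.closure_induction with
  | mem x hx =>
    obtain ⟨β, β', hβ, hβ', rfl⟩ := hx
    have h1 : p β ≤ 1 := le_hasSum hsum β fun b _ => hnn b
    have h := tendsto_norm_pow_mul_sub (lt_min hβ hβ') ((min_le_left _ _).trans h1) hP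
      (norm_translation_le β) (norm_translation_le β') (commute_translation β β')
      (commute_averaging_translation p hsum.summable β)
      (commute_averaging_translation p hsum.summable β')
      (norm_averaging_sub_smul_translation_le hnn hsum (min_le_left _ _))
      (norm_averaging_sub_smul_translation_le hnn hsum (min_le_right _ _))
    have e : translation (β - β') - 1 = (translation β - translation β') * translation (-β') := by
      rw [sub_mul, translation_mul, translation_mul, add_neg_cancel, translation_zero,
        sub_eq_add_neg β]
    rw [e]
    exact hright _ h
  | zero => simp [translation_zero]
  | add x y _ _ hx hy =>
    have e : translation (x + y) - 1 = (translation x - 1) * translation y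
        + (translation y - 1) := by
      rw [sub_mul, translation_mul, one_mul, sub_add_sub_cancel]
    refine squeeze_zero (fun _ => norm_nonneg _) (fun n => ?_)
      (by simpa using (hright y hx).add hy)
    rw [e, mul_add]
    exact norm_add_le _ _
  | neg x _ hx =>
    have e : translation (-x) - 1 = -((translation x - 1) * translation (-x)) := by
      rw [sub_mul, translation_mul, one_mul, add_neg_cancel, translation_zero, neg_sub]
    simpa only [e, mul_neg, norm_neg] using hright (-x) hx

lemma summable_mul_sub {a b : (Fin d → ℤ) → ℝ} (ha : Summable a) (hb : Summable b) :
    Summable fun x : (Fin d → ℤ) × (Fin d → ℤ) => a x.1 * b (x.2 - x.1) := by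
  have h : Summable fun x : (Fin d → ℤ) × (Fin d → ℤ) => a x.1 * b x.2 :=
    summable_mul_of_summable_norm ha.norm hb.norm
  let e : (Fin d → ℤ) × (Fin d → ℤ) ≃ (Fin d → ℤ) × (Fin d → ℤ) :=
    Equiv.prodShear (Equiv.refl _) fun γ => Equiv.subRight γ
  exact e.summable_iff.2 h

lemma summable_convZ {a b : (Fin d → ℤ) → ℝ} (ha : Summable a) (hb : Summable b) :
    Summable (convZ a b) :=
  (summable_mul_sub ha hb).prod_symm.prod

lemma averaging_convZ {a b : (Fin d → ℤ) → ℝ} (ha : Summable a) (hb : Summable b) :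
    averaging (convZ a b) = averaging a * averaging b := by
  ext g α
  rw [averaging_apply (summable_convZ ha hb), mul_apply_eq_comp,
    averaging_apply ha]
  have hF : Summable fun x : (Fin d → ℤ) × (Fin d → ℤ) =>
      a x.1 * b (x.2 - x.1) * g (α + x.2) := by
    refine Summable.of_norm_bounded ((summable_mul_sub ha hb).norm.mul_right ‖g‖) fun x => ?_
    rw [norm_mul]
    exact mul_le_mul_of_nonneg_left (g.norm_apply_le _) (norm_nonneg _)
  calc ∑' β, convZ a b β * g (α + β)
      = ∑' β, ∑' γ, a γ * b (β - γ) * g (α + β) := by simp only [convZ, tsum_mul_right]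
    _ = ∑' γ, ∑' β, a γ * b (β - γ) * g (α + β) := hF.tsum_comm
    _ = ∑' γ, a γ * averaging b g (α + γ) := by
      refine tsum_congr fun γ => ?_
      rw [averaging_apply hb, ← tsum_mul_left, ← (Equiv.addRight γ).tsum_eq]
      refine tsum_congr fun β => ?_
      rw [Equiv.coe_addRight, add_sub_cancel_right, mul_assoc, add_assoc, add_comm γ β]

lemma summable_convPow {p : (Fin d → ℤ) → ℝ} (hp : Summable p) (n : ℕ) :
    Summable (convPow p n) := by
  induction n with
  | zero => exact (hasSum_ite_eq 0 1).summable
  | succ n ih => exact summable_convZ hp ih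

lemma averaging_convPow {p : (Fin d → ℤ) → ℝ} (hp : Summable p) (n : ℕ) :
    averaging (convPow p n) = averaging p ^ n := by
  induction n with
  | zero =>
    rw [averaging, tsum_eq_single 0 fun β hβ => by simp [convPow, hβ]]
    simp [convPow, translation_zero]
  | succ n ih => rw [convPow, averaging_convZ hp (summable_convPow hp n), ih, pow_succ']

lemma averaging_const {p : (Fin d → ℤ) → ℝ} (hsum : HasSum p 1) (a : ℝ) :
    averaging p (.const d a) = .const d a := by
  ext α
  rw [averaging_apply hsum.summable]
  simp [tsum_mul_right, hsum.tsum_eq]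

end Averaging

/-- If `f : ℤ^d → ℝ` is bounded and its box averages converge, uniformly in the center
of the box, to `A`, then `Σ_β p^{(n)}_β f_β → A` as `n → ∞`. -/
theorem conv_avg_tendsto (d : ℕ) (hd : 1 ≤ d) (p : (Fin d → ℤ) → ℝ)
    (hnn : ∀ β, 0 ≤ p β) (hsum : HasSum p 1)
    (hmom : Summable fun β : Fin d → ℤ =>
      Real.sqrt (∑ i, ((β i : ℝ)) ^ 2) ^ (max 2 (d / 2 + 1)) * p β)
    (hspan : AddSubgroup.closure
      {γ : Fin d → ℤ | ∃ β β', 0 < p β ∧ 0 < p β' ∧ γ = β - β'} = ⊤)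
    (f : (Fin d → ℤ) → ℝ) (C : ℝ) (hf : ∀ β, |f β| ≤ C) (A : ℝ)
    (havg : ∀ ε > 0, ∃ R : ℕ, ∀ r : ℕ, R ≤ r → ∀ α : Fin d → ℤ,
      |(∑ β ∈ Finset.Icc (fun i => α i - (r : ℤ)) (fun i => α i + (r : ℤ)), f β)
          / ((2 * (r : ℝ) + 1) ^ d) - A| < ε) :
    Tendsto (fun n : ℕ => ∑' β : Fin d → ℤ, convPow p n β * f β) atTop (𝓝 A) := by
  have hP : ‖averaging p‖ ≤ 1 := norm_averaging_le hnn hsum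
  let F : BddFun d := .mk f C hf
  have hval (n : ℕ) : ∑' β, convPow p n β * f β = (averaging p ^ n) F 0 := by
    rw [← averaging_convPow hsum.summable, averaging_apply (summable_convPow hsum.summable n)]
    simp [F]
  simp only [hval]
  have hconst (n : ℕ) : (averaging p ^ n) (.const d A) = .const d A := by
    induction n with
    | zero => rfl
    | succ n ih => rw [pow_succ, mul_apply_eq_comp, averaging_const hsum, ih]
  rw [Metric.tendsto_atTop']
  intro ε hε
  obtain ⟨r, hr⟩ := havg (ε / 2) (half_pos hε)
  let B : Finset (Fin d → ℤ) := Finset.Icc (fun _ => -(r : ℤ)) (fun _ => (r : ℤ))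
  let w : ℝ := (2 * (r : ℝ) + 1) ^ d
  have hw : 0 < w := by positivity
  have hcard : (B.card : ℝ) = w := by
    simp only [B, w, Pi.card_Icc, Int.card_Icc, Finset.prod_const, Finset.card_univ,
      Fintype.card_fin, Nat.cast_pow]
    congr 1
    have : ((r : ℤ) + 1 - -(r : ℤ)).toNat = 2 * r + 1 := by omega
    rw [this]
    push_cast
    ring
  let G : BddFun d →L[ℝ] BddFun d := w⁻¹ • ∑ β ∈ B, translation β
  have hGF : ‖G F - .const d A‖ ≤ ε / 2 := by
    refine BddFun.norm_le (half_pos hε).le fun α => ?_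
    have e : (G F) α = (∑ β ∈ Finset.Icc (fun i => α i - (r : ℤ)) (fun i => α i + (r : ℤ)), f β)
        / w := by
      have hB : Finset.Icc (fun i => α i - (r : ℤ)) (fun i => α i + (r : ℤ))
          = B.map (addLeftEmbedding α) := by
        rw [Finset.map_add_left_Icc]
        rfl
      rw [hB, Finset.sum_map, div_eq_inv_mul]
      simp [G, F]
    simpa [e] using (hr r le_rfl α).le
  have hlim : Tendsto (fun n => ‖averaging p ^ n * (G - 1)‖ * ‖F‖) atTop (𝓝 0) := by
    have hG : G - 1 = w⁻¹ • ∑ β ∈ B, (translation β - 1) := by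
      rw [Finset.sum_sub_distrib, smul_sub, Finset.sum_const, ← Nat.cast_smul_eq_nsmul ℝ, hcard,
        smul_smul, inv_mul_cancel₀ hw.ne', one_smul]
    have hs : Tendsto (fun n => w⁻¹ * ∑ β ∈ B, ‖averaging p ^ n * (translation β - 1)‖)
        atTop (𝓝 0) := by
      simpa using (tendsto_finsetSum B fun β _ =>
        tendsto_norm_averaging_pow_mul_translation_sub_one hnn hsum hspan β).const_mul w⁻¹
    have : Tendsto (fun n => ‖averaging p ^ n * (G - 1)‖) atTop (𝓝 0) := by
      refine squeeze_zero (fun _ => norm_nonneg _) (fun n => ?_) hs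
      rw [hG, mul_smul_comm, Finset.mul_sum, norm_smul, Real.norm_of_nonneg (inv_nonneg.2 hw.le)]
      exact mul_le_mul_of_nonneg_left (norm_sum_le _ _) (inv_nonneg.2 hw.le)
    simpa using this.mul_const ‖F‖
  obtain ⟨N, hN⟩ := eventually_atTop.1 (hlim.eventually_lt_const (half_pos hε))
  refine ⟨N, fun n hn => ?_⟩
  have e : (averaging p ^ n) F - .const d A
      = (averaging p ^ n) (G F - .const d A) - (averaging p ^ n * (G - 1)) F := by
    rw [map_sub, hconst, mul_apply_eq_comp, sub_apply, map_sub,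
      one_apply_eq_self]
    abel
  have h1 : ‖(averaging p ^ n) (G F - .const d A)‖ ≤ ε / 2 :=
    ((ContinuousLinearMap.le_of_opNorm_le _ (norm_pow_le_one hP n) _).trans_eq
      (one_mul _)).trans hGF
  have h2 := ((averaging p ^ n * (G - 1)).le_opNorm F).trans_lt (hN n hn.le)
  calc dist ((averaging p ^ n) F 0) A
      = ‖((averaging p ^ n) F - .const d A) 0‖ := by rw [dist_eq_norm]; rfl
    _ ≤ ‖(averaging p ^ n) F - .const d A‖ := BddFun.norm_apply_le _ _
    _ < ε := by
      rw [e]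
      linarith [norm_sub_le ((averaging p ^ n) (G F - .const d A))
        ((averaging p ^ n * (G - 1)) F)]
end
end
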